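/- Let θ ∈ ℝ/ℤ be an angle that is not periodic under the doubling map and not recurrent under doubling, let h > 0, and let F : ℝ/ℤ → ℝ be a function for which there exists N ∈ ℕ such that every angle φ ≠ θ with diff(ν(θ), ν(φ)) > N satisfies |F(φ) − F(θ)| < e^{−h·diff(ν(θ),ν(φ))}. Then for every ε ∈ (0, h) there exists δ > 0 such that every angle φ with 0 < dist(φ, θ) < δ satisfies |F(φ) − F(θ)| ≤ 2 · dist(φ, θ)^{(h−ε)/log 2}. In particular, F is Hölder continuous at θ with exponent (h−ε)/log 2 for every ε ∈ (0,h). -/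

import Mathlib

noncomputable instance : Fact ((0:ℝ) < 1) := ⟨one_pos⟩

/-- The representative in `[0,1)` of a point of the circle `ℝ/ℤ`. -/
noncomputable def rep (x : AddCircle (1 : ℝ)) : ℝ :=
  (AddCircle.equivIco 1 0 x : ℝ)

open Classical in
/-- The kneading sequence of the angle `θ`: with `t ∈ [0,1)` the representative of `θ`,
the `k`-th entry records whether `2^(k-1) θ` lies in the open arc `A₁ = (t/2, (t+1)/2)`
containing `θ`, in the complementary open arc `A₀`, or is one of the two boundary points
`θ/2, (θ+1)/2` (the symbol `⋆`, encoded as `none`). Positions start at `1`. -/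
noncomputable def nu (θ : AddCircle (1 : ℝ)) (k : ℕ) : Option Bool :=
  let t := rep θ
  let x := rep ((2 ^ (k - 1) : ℕ) • θ)
  if x = t / 2 ∨ x = (t + 1) / 2 then none
  else if t / 2 < x ∧ x < (t + 1) / 2 then some true
  else some false

/-- Position of the first genuinely different entry (positions `≥ 1`), with `⋆ = none`
acting as a wildcard; `∞` if there is none. -/
noncomputable def diffW (a b : ℕ → Option Bool) : ℕ∞ :=
  sInf {k : ℕ∞ | ∃ n : ℕ, k = (n : ℕ∞) ∧ 1 ≤ n ∧
    ∃ x y : Bool, a n = some x ∧ b n = some y ∧ x ≠ y}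


/-- `θ` is periodic under the angle-doubling map. -/
def DoublingPeriodic (θ : AddCircle (1 : ℝ)) : Prop :=
  ∃ n, 1 ≤ n ∧ (2 ^ n : ℕ) • θ = θ

/-- `θ` is recurrent under the angle-doubling map. -/
def DoublingRecurrent (θ : AddCircle (1 : ℝ)) : Prop :=
  θ ∈ closure {x : AddCircle (1 : ℝ) | ∃ n, 1 ≤ n ∧ x = (2 ^ n : ℕ) • θ}

/-- The real number `x` has distance at least `c` from every integer. -/
def FarFromInt (c x : ℝ) : Prop := ∀ k : ℤ, c ≤ |x - k|

/-- No entry of the kneading sequence of `s` genuinely differs from that of the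
non-periodic angle `t`: the `n`-th entry is given by the parity of `⌊2 ^ n * t - t⌋`. -/
def KneadingCompatible (t s : ℝ) : Prop :=
  ∀ n : ℕ, 1 ≤ n → (∀ k : ℤ, 2 ^ n * s - s ≠ k) →
    (Even ⌊2 ^ n * t - t⌋ ↔ Even ⌊2 ^ n * s - s⌋)

lemma FarFromInt.mono {c d x : ℝ} (hx : FarFromInt d x) (hcd : c ≤ d) : FarFromInt c x :=
  fun k => hcd.trans (hx k)

lemma FarFromInt.floor_eq {d z w : ℝ} (hz : FarFromInt d z) (hw : |w - z| < d) :
    ⌊w⌋ = ⌊z⌋ := by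
  have h1 := hz ⌊z⌋
  have h2 := hz (⌊z⌋ + 1)
  have h3 := Int.floor_le z
  have h4 := Int.lt_floor_add_one z
  push_cast at h2
  rw [abs_of_nonneg (by linarith)] at h1
  rw [abs_of_nonpos (by linarith)] at h2
  rw [abs_lt] at hw
  rw [Int.floor_eq_iff]
  constructor <;> linarith [hw.1, hw.2]

/-- Doubling expands the distance of two points in the same half of the circle, unless it
already exceeds the distance of the image of one of them from `t`. -/
lemma FarFromInt.two_mul_sub {t c r u v : ℝ}
    (huv : Even ⌊2 * u - t⌋ ↔ Even ⌊2 * v - t⌋)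
    (hu : FarFromInt c (2 * u - t)) (hr : FarFromInt r (u - v)) :
    FarFromInt (min (2 * r) c) (2 * u - 2 * v) := by
  intro k
  rcases Int.even_or_odd' k with ⟨l, rfl | rfl⟩
  · refine (min_le_left _ _).trans ?_
    have h1 := hr l
    have h2 : 2 * u - 2 * v - ((2 * l : ℤ) : ℝ) = 2 * (u - v - l) := by push_cast; ring
    rw [h2, abs_mul, abs_two]
    linarith
  · refine (min_le_right _ _).trans ?_
    obtain ⟨m, hm⟩ : Even (⌊2 * u - t⌋ - ⌊2 * v - t⌋) := by
      rw [Int.even_sub]; exact huv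
    have h1 := hu ⌊2 * u - t⌋
    have h2 := hu (⌊2 * u - t⌋ + 1)
    have h3 := Int.floor_le (2 * u - t)
    have h4 := Int.lt_floor_add_one (2 * u - t)
    have h5 := Int.floor_le (2 * v - t)
    have h6 := Int.lt_floor_add_one (2 * v - t)
    push_cast at h2
    rw [abs_of_nonneg (by linarith)] at h1
    rw [abs_of_nonpos (by linarith)] at h2
    have hm' : (⌊2 * u - t⌋ : ℝ) - ⌊2 * v - t⌋ = m + m := by exact_mod_cast hm
    push_cast
    rcases lt_or_ge l m with hlm | hlm
    · have : (l : ℝ) + 1 ≤ m := by exact_mod_cast hlm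
      rw [le_abs]; left; linarith
    · have : (m : ℝ) ≤ l := by exact_mod_cast hlm
      rw [le_abs]; right; linarith

/-- Points with the same itinerary, one of whose orbits stays away from `t`, separate. -/
lemma farFromInt_iterate {t c r u v : ℝ} (hr0 : 0 ≤ r) (hc : 0 ≤ c) (N : ℕ)
    (huv : ∀ n < N, (Even ⌊2 ^ (n + 1) * u - t⌋ ↔ Even ⌊2 ^ (n + 1) * v - t⌋))
    (hu : ∀ n, FarFromInt c (2 ^ (n + 1) * u - t)) (hr : FarFromInt r (u - v)) :
    FarFromInt (min (2 ^ N * r) c) (2 ^ N * u - 2 ^ N * v) := by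
  induction N with
  | zero => simpa using hr.mono (min_le_left r c)
  | succ N ih =>
    have e : ∀ x : ℝ, 2 ^ (N + 1) * x = 2 * (2 ^ N * x) := fun x => by ring
    have h1 := huv N (Nat.lt_succ_self N)
    have h2 := hu N
    rw [e, e] at h1
    rw [e] at h2
    have h3 := FarFromInt.two_mul_sub h1 h2 (ih fun n hn => huv n (by omega))
    rw [e, e, e]
    refine h3.mono ?_
    have h4 : 0 ≤ 2 ^ N * r := by positivity
    rcases le_total (2 ^ N * r) c with h | h
    · rw [min_eq_left h]
    · rw [min_eq_right h]
      exact le_min ((min_le_right _ _).trans (by linarith)) (min_le_right _ _)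

/-- Only boundedly many points of the circle can be pairwise `c`-separated. -/
lemma exists_card_bound_of_separated {c : ℝ} (hc : 0 < c) :
    ∃ K : ℕ, ∀ (J : Finset ℕ) (p : ℕ → ℝ), K < J.card →
      ∃ i ∈ J, ∃ j ∈ J, i < j ∧ ¬ FarFromInt c (p i - p j) := by
  obtain ⟨K, hK⟩ := exists_nat_gt (1 / c)
  have hK0 : (0 : ℝ) < K := lt_trans (by positivity) hK
  refine ⟨K, fun J p hJ => ?_⟩
  have key : ∀ i j, ⌊Int.fract (p i) * K⌋₊ = ⌊Int.fract (p j) * K⌋₊ →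
      ¬ FarFromInt c (p i - p j) := by
    intro i j hij hf
    have h1 := hf (⌊p i⌋ - ⌊p j⌋)
    have h2 : p i - p j - ((⌊p i⌋ - ⌊p j⌋ : ℤ) : ℝ) = Int.fract (p i) - Int.fract (p j) := by
      push_cast [Int.fract]; ring
    have a0 : 0 ≤ Int.fract (p i) * K := mul_nonneg (Int.fract_nonneg _) hK0.le
    have b0 : 0 ≤ Int.fract (p j) * K := mul_nonneg (Int.fract_nonneg _) hK0.le
    have a1 := Nat.floor_le a0
    have b1 := Nat.floor_le b0
    have a2 := Nat.lt_floor_add_one (Int.fract (p i) * K)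
    have b2 := Nat.lt_floor_add_one (Int.fract (p j) * K)
    rw [hij] at a1 a2
    rw [h2] at h1
    have h3 : |(Int.fract (p i) - Int.fract (p j)) * K| < 1 := by
      rw [abs_lt, sub_mul]; constructor <;> linarith
    rw [abs_mul, abs_of_pos hK0] at h3
    rw [div_lt_iff₀ hc] at hK
    nlinarith
  obtain ⟨i, hi, j, hj, hne, hij⟩ := Finset.exists_ne_map_eq_of_card_lt_of_maps_to
    (s := J) (t := Finset.range K) (f := fun i => ⌊Int.fract (p i) * K⌋₊) (by simpa using hJ)
    (by
      intro i _
      simp only [Finset.coe_range, Set.mem_Iio]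
      rw [Nat.floor_lt (mul_nonneg (Int.fract_nonneg _) hK0.le)]
      nlinarith [Int.fract_lt_one (p i)])
  rcases lt_or_gt_of_ne hne with h | h
  · exact ⟨i, hi, j, hj, h, key i j hij⟩
  · exact ⟨j, hj, i, hi, h, key j i hij.symm⟩

/-- The kneading sequence of an angle that is not recurrent is itself not recurrent. -/
lemma exists_kneading_disagreement {t c : ℝ} (hc : 0 < c)
    (ht : ∀ n : ℕ, 1 ≤ n → FarFromInt c (2 ^ n * t - t)) :
    ∃ N : ℕ, ∀ n : ℕ, 1 ≤ n → ∃ k < N,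
      ¬ (Even ⌊2 ^ (n + k + 1) * t - t⌋ ↔ Even ⌊2 ^ (k + 1) * t - t⌋) := by
  by_contra! hcon
  choose a ha1 ha using hcon
  let s : ℕ → ℕ := fun i => Nat.rec 0 (fun _ m => m + a m) i
  have hs : ∀ i, s (i + 1) = s i + a (s i) := fun i => rfl
  have hmono : StrictMono s := strictMono_nat_of_lt_succ fun i => by
    rw [hs]; have := ha1 (s i); omega
  have agree : ∀ l j k, k < s l →
      (Even ⌊2 ^ (s (l + j) - s l + k + 1) * t - t⌋ ↔ Even ⌊2 ^ (k + 1) * t - t⌋) := by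
    intro l j
    induction j with
    | zero => intro k _; simp
    | succ j ih =>
      intro k hk
      rw [← ih k hk]
      have hle : s l ≤ s (l + j) := hmono.monotone (Nat.le_add_right _ _)
      have h1 := ha (s (l + j)) (s (l + j) - s l + k) (by omega)
      have e : s (l + (j + 1)) - s l + k + 1
          = a (s (l + j)) + (s (l + j) - s l + k) + 1 := by
        rw [← add_assoc, hs]; omega
      rw [e]
      exact h1
  obtain ⟨K, hK⟩ := exists_card_bound_of_separated hc
  obtain ⟨i, -, j, -, hij, hnf⟩ := hK (Finset.range (K + 1)) (fun i => 2 ^ s i * t) (by simp)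
  apply hnf
  obtain ⟨m, rfl⟩ := Nat.exists_eq_add_of_lt hij
  have hlt : s i < s (i + m + 1) := hmono hij
  have hsep := farFromInt_iterate (t := t) (c := c) (r := c) (u := t)
    (v := 2 ^ (s (i + m + 1) - s i) * t) hc.le hc.le (s i)
    (fun n hn => by
      rw [← agree i (m + 1) n hn, ← mul_assoc, ← pow_add]
      have : n + 1 + (s (i + m + 1) - s i) = s (i + (m + 1)) - s i + n + 1 := by
        rw [← add_assoc i m 1]; omega
      rw [this])
    (fun n => ht _ (by omega))
    (fun k => by
      have := ht (s (i + m + 1) - s i) (by omega) (-k)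
      push_cast at this
      rw [abs_sub_comm] at this
      calc c ≤ _ := this
        _ = _ := by congr 1; ring)
  have e : (2 : ℝ) ^ s i * (2 ^ (s (i + m + 1) - s i) * t) = 2 ^ s (i + m + 1) * t := by
    rw [← mul_assoc, ← pow_add]; congr 2; omega
  rw [e] at hsep
  refine hsep.mono (le_min ?_ le_rfl)
  have : (1 : ℝ) ≤ 2 ^ s i := one_le_pow₀ (by norm_num)
  nlinarith

/-- The orbit of an angle near `t` with compatible kneading sequence stays away from `t`. -/
lemma exists_farFromInt_of_compatible {t c : ℝ} (hc : 0 < c)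
    (ht : ∀ n : ℕ, 1 ≤ n → FarFromInt c (2 ^ n * t - t)) :
    ∃ b : ℝ, 0 < b ∧ b < 1 / 4 ∧ ∀ s : ℝ, KneadingCompatible t s → |s - t| < b →
      ∀ n : ℕ, 1 ≤ n → FarFromInt b (2 ^ n * s - t) := by
  obtain ⟨N, hN⟩ := exists_kneading_disagreement hc ht
  obtain ⟨b, hb0, hb⟩ : ∃ b : ℝ, 0 < b ∧ b < min (1 / 4) (c / (2 ^ (N + 1) + 1)) :=
    exists_between (by positivity)
  have hb1 : b * (2 ^ (N + 1) + 1) < c := by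
    rw [← lt_div_iff₀ (by positivity)]; exact hb.trans_le (min_le_right _ _)
  refine ⟨b, hb0, hb.trans_le (min_le_left _ _), fun s hs hst n hn j => ?_⟩
  by_contra! hlt
  obtain ⟨k, hk, hdis⟩ := hN n hn
  apply hdis
  have hpow : (2 : ℝ) ^ (k + 1) ≤ 2 ^ (N + 1) := pow_le_pow_right₀ (by norm_num) (by omega)
  have hpert : |2 ^ (n + k + 1) * s - s - ((2 ^ (k + 1) * j : ℤ) : ℝ)
      - (2 ^ (k + 1) * t - t)| < c := by
    have e : 2 ^ (n + k + 1) * s - s - ((2 ^ (k + 1) * j : ℤ) : ℝ) - (2 ^ (k + 1) * t - t)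
        = 2 ^ (k + 1) * (2 ^ n * s - t - j) - (s - t) := by
      push_cast; rw [show n + k + 1 = n + (k + 1) by ring, pow_add]; ring
    rw [e]
    calc _ ≤ |2 ^ (k + 1) * (2 ^ n * s - t - j)| + |s - t| := abs_sub _ _
      _ = 2 ^ (k + 1) * |2 ^ n * s - t - j| + |s - t| := by
        rw [abs_mul, abs_of_pos (by positivity : (0 : ℝ) < 2 ^ (k + 1))]
      _ ≤ 2 ^ (N + 1) * b + b := by gcongr
      _ < c := by linarith
  have hfl := (ht (k + 1) (by omega)).floor_eq hpert
  rw [Int.floor_sub_intCast] at hfl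
  have hns : ∀ i : ℤ, 2 ^ (n + k + 1) * s - s ≠ i := by
    intro i hi
    have h1 := ht (k + 1) (by omega) (i - 2 ^ (k + 1) * j)
    rw [hi] at hpert
    rw [abs_sub_comm] at h1
    push_cast at h1 hpert
    linarith
  rw [hs (n + k + 1) (by omega) hns, ← hfl, Int.even_sub]
  have : Even ((2 : ℤ) ^ (k + 1) * j) := ((even_two.pow_of_ne_zero (by omega)).mul_right j)
  simp [this]

/-- Near a non-recurrent angle, every other angle has a genuinely different kneading sequence. -/
lemma exists_not_kneadingCompatible {t c : ℝ} (hc : 0 < c)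
    (ht : ∀ n : ℕ, 1 ≤ n → FarFromInt c (2 ^ n * t - t)) :
    ∃ r : ℝ, 0 < r ∧ ∀ s : ℝ, s ≠ t → |s - t| < r → ¬ KneadingCompatible t s := by
  obtain ⟨b, hb0, hb4, hb⟩ := exists_farFromInt_of_compatible hc ht
  by_contra! hcon
  have hcode : ∀ s, KneadingCompatible t s → |s - t| < b → ∀ n : ℕ,
      (Even ⌊2 ^ (n + 1) * t - t⌋ ↔ Even ⌊2 ^ (n + 1) * s - t⌋) := by
    intro s hs hst n
    have hf := hb s hs hst (n + 1) (by omega)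
    have hns : ∀ i : ℤ, 2 ^ (n + 1) * s - s ≠ i := by
      intro i hi
      have := hf i
      rw [← hi] at this
      have e : 2 ^ (n + 1) * s - t - (2 ^ (n + 1) * s - s) = s - t := by ring
      rw [e] at this
      linarith
    rw [hs (n + 1) (by omega) hns, hf.floor_eq]
    rw [show 2 ^ (n + 1) * s - s - (2 ^ (n + 1) * s - t) = t - s by ring, abs_sub_comm]
    exact hst
  choose g hg0 hg1 hg2 using hcon
  have hex : ∃ p : ℕ → ℝ, (∀ i, KneadingCompatible t (p i) ∧ |p i - t| < b) ∧
      Function.Injective p := by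
    have hinf : {s : ℝ | KneadingCompatible t s ∧ |s - t| < b ∧ s ≠ t}.Infinite := by
      intro hfin
      obtain ⟨ρ, hρ, hball⟩ := Metric.isOpen_iff.1 hfin.isClosed.isOpen_compl t (by simp)
      have hpos : 0 < min ρ b := lt_min hρ hb0
      have hlt := hg1 _ hpos
      exact hball (a := g _ hpos) (by
        rw [Metric.mem_ball, Real.dist_eq]; exact hlt.trans_le (min_le_left _ _))
        ⟨hg2 _ hpos, hlt.trans_le (min_le_right _ _), hg0 _ hpos⟩
    let q := hinf.natEmbedding
    exact ⟨fun i => q i, fun i => ⟨(q i).2.1, (q i).2.2.1⟩,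
      Subtype.val_injective.comp q.injective⟩
  obtain ⟨p, hp, hinj⟩ := hex
  obtain ⟨K, hK⟩ := exists_card_bound_of_separated hb0
  obtain ⟨N, hN⟩ : ∃ N : ℕ, ∀ i ∈ Finset.range (K + 1), ∀ j ∈ Finset.range (K + 1),
      i < j → b ≤ 2 ^ N * |p i - p j| := by
    have hev : ∀ᶠ N : ℕ in Filter.atTop, ∀ i ∈ Finset.range (K + 1),
        ∀ j ∈ Finset.range (K + 1), i < j → b ≤ 2 ^ N * |p i - p j| := by
      rw [Filter.eventually_all_finset]
      intro i _
      rw [Filter.eventually_all_finset]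
      intro j _
      by_cases hij : i < j
      · have hpos : 0 < |p i - p j| := abs_pos.2 (sub_ne_zero.2 (hinj.ne hij.ne))
        have := (tendsto_pow_atTop_atTop_of_one_lt (one_lt_two (α := ℝ))).atTop_mul_const hpos
        filter_upwards [this.eventually_ge_atTop b] with N hN _ using hN
      · exact Filter.Eventually.of_forall fun N h => absurd h hij
    exact hev.exists
  obtain ⟨i, hi, j, hj, hij, hnf⟩ := hK (Finset.range (K + 1)) (fun i => 2 ^ N * p i) (by simp)
  apply hnf
  have hsep := farFromInt_iterate (t := t) (c := b) (r := |p i - p j|) (u := p i) (v := p j)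
    (abs_nonneg _) hb0.le N
    (fun n _ => (hcode _ (hp i).1 (hp i).2 n).symm.trans (hcode _ (hp j).1 (hp j).2 n))
    (fun n => hb _ (hp i).1 (hp i).2 _ (by omega))
    (fun k => by
      have hlt : |p i - p j| < 1 / 2 := by
        have := abs_sub_le (p i) t (p j)
        have h2 := (hp j).2
        rw [abs_sub_comm] at h2
        linarith [(hp i).2]
      rw [abs_lt] at hlt
      rcases lt_trichotomy k 0 with h | rfl | h
      · have : (k : ℝ) ≤ -1 := by exact_mod_cast (by omega : k ≤ -1)
        rw [le_abs]; left
        rw [abs_le']; constructor <;> linarith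
      · simp
      · have : (1 : ℝ) ≤ k := by exact_mod_cast h
        rw [le_abs]; right
        rw [abs_le']; constructor <;> linarith)
  exact hsep.mono (le_min (hN i hi j hj hij) le_rfl)

lemma rep_mem (θ : AddCircle (1 : ℝ)) : 0 ≤ rep θ ∧ rep θ < 1 := by
  have h := (AddCircle.equivIco 1 0 θ).2
  exact ⟨h.1, h.2.trans_eq (zero_add 1)⟩

lemma coe_rep (θ : AddCircle (1 : ℝ)) : ((rep θ : ℝ) : AddCircle (1 : ℝ)) = θ :=
  (AddCircle.equivIco 1 0).symm_apply_apply θ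

lemma rep_coe (x : ℝ) : rep (x : AddCircle (1 : ℝ)) = Int.fract x := by
  rw [rep, AddCircle.coe_equivIco_mk_apply]; simp

open Classical in
/-- A kneading entry in terms of the parity of `⌊2 * x - t⌋`. -/
lemma kneading_entry_eq {t x : ℝ} (h0 : 0 ≤ t) (h1 : t < 1) (x0 : 0 ≤ x) (x1 : x < 1) :
    (if x = t / 2 ∨ x = (t + 1) / 2 then none
      else if t / 2 < x ∧ x < (t + 1) / 2 then some true else some false)
    = if ∃ k : ℤ, 2 * x - t = k then none else some (decide (Even ⌊2 * x - t⌋)) := by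
  by_cases hstar : x = t / 2 ∨ x = (t + 1) / 2
  · rw [if_pos hstar, if_pos]
    rcases hstar with rfl | rfl
    · exact ⟨0, by push_cast; ring⟩
    · exact ⟨1, by push_cast; ring⟩
  · rw [if_neg hstar]
    push Not at hstar
    have hno : ¬ ∃ k : ℤ, 2 * x - t = k := by
      rintro ⟨k, hk⟩
      have hk1 : -1 < k := by
        have : (-1 : ℝ) < k := by linarith
        exact_mod_cast this
      have hk2 : k < 2 := by
        have : (k : ℝ) < 2 := by linarith
        exact_mod_cast this
      obtain rfl | rfl : k = 0 ∨ k = 1 := by omega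
      · exact hstar.1 (by push_cast at hk; linarith)
      · exact hstar.2 (by push_cast at hk; linarith)
    rw [if_neg hno]
    by_cases hin : t / 2 < x ∧ x < (t + 1) / 2
    · have : ⌊2 * x - t⌋ = 0 := by
        rw [Int.floor_eq_iff]; push_cast; constructor <;> linarith [hin.1, hin.2]
      simp [hin, this]
    · rw [if_neg hin]
      rcases lt_or_gt_of_ne hstar.1 with h | h
      · have : ⌊2 * x - t⌋ = -1 := by
          rw [Int.floor_eq_iff]; push_cast; constructor <;> linarith
        simp [this]
      · have h2 : (t + 1) / 2 ≤ x := not_lt.1 fun h' => hin ⟨h, h'⟩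
        have : ⌊2 * x - t⌋ = 1 := by
          rw [Int.floor_eq_iff]; push_cast; constructor <;> linarith
        simp [this]

open Classical in
/-- The kneading sequence in terms of the parity of `⌊2 ^ n * t - t⌋`. -/
lemma nu_eq (θ : AddCircle (1 : ℝ)) (n : ℕ) :
    nu θ (n + 1) = if ∃ k : ℤ, 2 ^ (n + 1) * rep θ - rep θ = k then none
      else some (decide (Even ⌊2 ^ (n + 1) * rep θ - rep θ⌋)) := by
  obtain ⟨h0, h1⟩ := rep_mem θ
  have hx : rep ((2 ^ n : ℕ) • θ) = Int.fract (2 ^ n * rep θ) := by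
    conv_lhs => rw [← coe_rep θ, ← AddCircle.coe_nsmul, rep_coe]
    simp
  simp only [nu, Nat.add_sub_cancel, hx]
  generalize rep θ = t at h0 h1
  have e : 2 ^ (n + 1) * t - t
      = 2 * Int.fract (2 ^ n * t) - t + ((2 * ⌊2 ^ n * t⌋ : ℤ) : ℝ) := by
    push_cast [Int.fract]; ring
  have hex : (∃ k : ℤ, 2 ^ (n + 1) * t - t = k)
      ↔ ∃ k : ℤ, 2 * Int.fract (2 ^ n * t) - t = k := by
    rw [e]
    constructor
    · rintro ⟨k, hk⟩
      exact ⟨k - 2 * ⌊2 ^ n * t⌋, by push_cast at hk ⊢; linarith⟩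
    · rintro ⟨k, hk⟩
      exact ⟨k + 2 * ⌊2 ^ n * t⌋, by push_cast at hk ⊢; linarith⟩
  have hev : Even ⌊2 ^ (n + 1) * t - t⌋ ↔ Even ⌊2 * Int.fract (2 ^ n * t) - t⌋ := by
    rw [e, Int.floor_add_intCast, Int.even_add]; simp
  rw [if_congr hex rfl rfl, decide_eq_decide.2 hev]
  exact kneading_entry_eq h0 h1 (Int.fract_nonneg _) (Int.fract_lt_one _)

/-- Two nearby angles, the first of which is not recurrent, first differ in their kneading
sequences at a late position. -/
lemma le_two_pow_mul_of_parity_ne {t s c : ℝ} {n : ℕ}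
    (ht : FarFromInt c (2 ^ n * t - t))
    (hne : ¬ (Even ⌊2 ^ n * t - t⌋ ↔ Even ⌊2 ^ n * s - s⌋)) : c ≤ 2 ^ n * |s - t| := by
  by_contra! hlt
  apply hne
  rw [ht.floor_eq (w := 2 ^ n * s - s)]
  have h1 : (1 : ℝ) ≤ 2 ^ n := one_le_pow₀ (by norm_num)
  rw [show 2 ^ n * s - s - (2 ^ n * t - t) = (2 ^ n - 1) * (s - t) by ring, abs_mul,
    abs_of_nonneg (by linarith)]
  nlinarith [abs_nonneg (s - t)]

/-- A non-recurrent angle has an orbit which stays away from it. -/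
lemma exists_farFromInt_of_not_recurrent {θ : AddCircle (1 : ℝ)}
    (hnr : ¬ DoublingRecurrent θ) :
    ∃ c : ℝ, 0 < c ∧ ∀ n : ℕ, 1 ≤ n → FarFromInt c (2 ^ n * rep θ - rep θ) := by
  rw [DoublingRecurrent, Metric.mem_closure_iff] at hnr
  push Not at hnr
  obtain ⟨c, hc, hfar⟩ := hnr
  refine ⟨c, hc, fun n hn k => ?_⟩
  have h1 := hfar _ ⟨n, hn, rfl⟩
  rw [dist_comm, dist_eq_norm] at h1
  have e : (2 ^ n : ℕ) • θ - θ = ((2 ^ n * rep θ - rep θ - k : ℝ) : AddCircle (1 : ℝ)) := by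
    conv_lhs => rw [← coe_rep θ]
    have hk : ((k : ℝ) : AddCircle (1 : ℝ)) = 0 := by
      rw [AddCircle.coe_eq_zero_iff]; exact ⟨k, by simp⟩
    rw [← AddCircle.coe_nsmul, AddCircle.coe_sub, AddCircle.coe_sub, hk]
    simp
  rw [e] at h1
  exact h1.trans (QuotientAddGroup.norm_mk_le_norm (S := AddSubgroup.zmultiples (1 : ℝ)))

/-- Angles near a nonzero angle have nearby representatives in `[0,1)`. -/
lemma abs_rep_sub_rep {θ φ : AddCircle (1 : ℝ)}
    (h : dist φ θ < min (rep θ) (1 - rep θ)) : |rep φ - rep θ| = dist φ θ := by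
  rw [dist_eq_norm] at h ⊢
  have e : φ - θ = ((rep φ - rep θ : ℝ) : AddCircle (1 : ℝ)) := by
    rw [AddCircle.coe_sub, coe_rep, coe_rep]
  have hnorm : ‖φ - θ‖ = |rep φ - rep θ - round (rep φ - rep θ)| := by
    rw [e]; exact UnitAddCircle.norm_eq
  rw [hnorm] at h ⊢
  obtain ⟨h0, h1⟩ := rep_mem φ
  rw [lt_min_iff, abs_lt, abs_lt] at h
  have hr : round (rep φ - rep θ) = 0 := by
    have a1 : (-1 : ℝ) < round (rep φ - rep θ) := by linarith [h.1.2]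
    have a2 : (round (rep φ - rep θ) : ℝ) < 1 := by linarith [h.2.1]
    have a1' : -1 < round (rep φ - rep θ) := by exact_mod_cast a1
    have a2' : round (rep φ - rep θ) < 1 := by exact_mod_cast a2
    omega
  rw [hr]; simp

/-- Hölder continuity in terms of external angles: if `θ` is non-periodic and
non-recurrent under doubling, `h > 0`, and `F` satisfies
`|F(φ) − F(θ)| < e^{−h·diff(ν(θ),ν(φ))}` whenever `φ ≠ θ` and `diff(ν(θ),ν(φ)) > N`,
then for every `ε ∈ (0,h)` there is `δ > 0` with
`|F(φ) − F(θ)| ≤ 2·dist(φ,θ)^{(h−ε)/log 2}` for all `φ` with `0 < dist(φ,θ) < δ`. -/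
theorem hoelder_for_angles (θ : AddCircle (1 : ℝ))
    (hnp : ¬ DoublingPeriodic θ) (hnr : ¬ DoublingRecurrent θ)
    (h : ℝ) (hh : 0 < h) (F : AddCircle (1 : ℝ) → ℝ) (N : ℕ)
    (hF : ∀ φ : AddCircle (1 : ℝ), φ ≠ θ →
      ∀ d : ℕ, diffW (nu θ) (nu φ) = (d : ℕ∞) → N < d →
      |F φ - F θ| < Real.exp (-h * d)) :
    ∀ ε : ℝ, 0 < ε → ε < h → ∃ δ : ℝ, 0 < δ ∧ ∀ φ : AddCircle (1 : ℝ),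
      0 < dist φ θ → dist φ θ < δ →
      |F φ - F θ| ≤ 2 * dist φ θ ^ ((h - ε) / Real.log 2) := by
  intro ε hε hεh
  obtain ⟨c, hc, hfar⟩ := exists_farFromInt_of_not_recurrent hnr
  obtain ⟨r, hr, hcompat⟩ := exists_not_kneadingCompatible hc hfar
  obtain ⟨ht0, ht1⟩ := rep_mem θ
  have htpos : 0 < rep θ := by
    refine lt_of_le_of_ne ht0 fun h0 => hnp ⟨1, le_rfl, ?_⟩
    rw [← coe_rep θ, ← h0]; simp
  refine ⟨min (min (min (rep θ) (1 - rep θ)) r)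
    (min (c / 2 ^ N) (Real.exp (h / ε * Real.log c))), ?_, fun φ hφ0 hφ => ?_⟩
  · have : 0 < 1 - rep θ := by linarith
    positivity
  simp only [lt_min_iff] at hφ
  obtain ⟨⟨hrep, hφr⟩, hφN, hφe⟩ := hφ
  have hdist := abs_rep_sub_rep (lt_min_iff.2 hrep)
  have hne : φ ≠ θ := dist_pos.1 hφ0
  have hlate : ∀ n : ℕ, 1 ≤ n → ∀ x y : Bool, nu θ n = some x → nu φ n = some y → x ≠ y →
      c ≤ 2 ^ n * dist φ θ := by
    intro n hn x y hx hy hxy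
    rw [← hdist]
    apply le_two_pow_mul_of_parity_ne (hfar n hn)
    intro hiff
    obtain ⟨m, rfl⟩ := Nat.exists_eq_succ_of_ne_zero (by omega : n ≠ 0)
    rw [nu_eq] at hx hy
    split_ifs at hx hy
    simp only [Option.some.injEq] at hx hy
    exact hxy (by rw [← hx, ← hy]; exact decide_eq_decide.2 hiff)
  have hex : ∃ n : ℕ, 1 ≤ n ∧ ∃ x y : Bool, nu θ n = some x ∧ nu φ n = some y ∧ x ≠ y := by
    have h1 := hcompat (rep φ)
      (fun he => hne (by rw [← coe_rep φ, he, coe_rep])) (by rw [hdist]; exact hφr)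
    simp only [KneadingCompatible, not_forall] at h1
    obtain ⟨n, hn, hns, hpar⟩ := h1
    obtain ⟨m, rfl⟩ := Nat.exists_eq_succ_of_ne_zero (by omega : n ≠ 0)
    have hnt : ¬ ∃ k : ℤ, 2 ^ (m + 1) * rep θ - rep θ = k := by
      rintro ⟨k, hk⟩
      have := hfar (m + 1) hn k
      rw [hk, sub_self, abs_zero] at this
      linarith
    classical
    refine ⟨m + 1, hn, _, _, (nu_eq θ m).trans (if_neg hnt),
      (nu_eq φ m).trans (if_neg (by rintro ⟨k, hk⟩; exact hns k hk)), ?_⟩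
    intro hd
    exact hpar (decide_eq_decide.1 hd)
  obtain ⟨n₀, hn₀⟩ := hex
  have hmem := csInf_mem (s := {k : ℕ∞ | ∃ n : ℕ, k = (n : ℕ∞) ∧ 1 ≤ n ∧
    ∃ x y : Bool, nu θ n = some x ∧ nu φ n = some y ∧ x ≠ y}) ⟨n₀, n₀, rfl, hn₀⟩
  obtain ⟨d, hd, hd1, x, y, hx, hy, hxy⟩ := hmem
  have hcd := hlate d hd1 x y hx hy hxy
  have hNd : N < d := by
    rw [lt_div_iff₀ (by positivity)] at hφN
    have h1 : (2 : ℝ) ^ N < 2 ^ d := by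
      have : dist φ θ * 2 ^ N < dist φ θ * 2 ^ d := by linarith
      exact lt_of_mul_lt_mul_left this hφ0.le
    exact (pow_lt_pow_iff_right₀ (by norm_num)).1 h1
  refine (hF φ hne d hd hNd).le.trans ?_
  have hL : 0 < Real.log 2 := Real.log_pos (by norm_num)
  have hpow : Real.exp (-h * d) ≤ dist φ θ ^ ((h - ε) / Real.log 2) := by
    rw [Real.rpow_def_of_pos hφ0, Real.exp_le_exp]
    have h1 : Real.log c ≤ d * Real.log 2 + Real.log (dist φ θ) := by
      rw [← Real.log_pow, ← Real.log_mul (by positivity) hφ0.ne']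
      exact Real.log_le_log hc hcd
    have h2 : Real.log (dist φ θ) < h / ε * Real.log c := by
      rwa [Real.log_lt_iff_lt_exp hφ0]
    have h3 : ε * Real.log (dist φ θ) < h * Real.log c := by
      have := mul_lt_mul_of_pos_left h2 hε
      rwa [← mul_assoc, mul_div_cancel₀ _ hε.ne'] at this
    have h4 := mul_le_mul_of_nonneg_left h1 hh.le
    rw [mul_div_assoc', le_div_iff₀ hL]
    nlinarith
  have : 0 ≤ dist φ θ ^ ((h - ε) / Real.log 2) := Real.rpow_nonneg hφ0.le _
  linarith
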